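/- Let m be a prime number with m < k, and suppose k is not congruent to 0 or −1 modulo m. Then for every ℓ ∈ {0, 1, …, m−1}, the number of partitions with at most k−m+1 parts, each part at most m−2, whose size is congruent to ℓ modulo m, equals C(k−1, m−2)/m. In particular m divides C(k−1, m−2), and this count is independent of ℓ. -/

import Mathlib

/-- A partition: a weakly decreasing list of positive integers. -/
def IsPartition (l : List ℕ) : Prop :=
  l.Pairwise (· ≥ ·) ∧ ∀ x ∈ l, 0 < x

/-- The `i`-th part (0-indexed), with parts beyond the length equal to 0. -/
def part (l : List ℕ) (i : ℕ) : ℕ := l.getD i 0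

/-- Diagram containment `l ⊆ m`: every part of `l` is at most the corresponding part of `m`. -/
def SubDiag (l m : List ℕ) : Prop := ∀ i, part l i ≤ part m i

/-- The partitions with at most `a` parts, each at most `b`. -/
def boxPartitions : ℕ → ℕ → Finset (List ℕ)
  | 0, _ => {[]}
  | _ + 1, 0 => {[]}
  | a + 1, b + 1 =>
    boxPartitions (a + 1) b ∪ (boxPartitions a (b + 1)).map ⟨List.cons (b + 1), List.cons_injective⟩

theorem mem_boxPartitions {a b : ℕ} {l : List ℕ} :
    l ∈ boxPartitions a b ↔ IsPartition l ∧ l.length ≤ a ∧ ∀ x ∈ l, x ≤ b := by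
  induction a, b using boxPartitions.induct generalizing l with
  | case1 b =>
    rw [boxPartitions, Finset.mem_singleton]
    constructor
    · rintro rfl
      simp [IsPartition]
    · rintro ⟨-, h, -⟩
      simpa using h
  | case2 a =>
    rw [boxPartitions, Finset.mem_singleton]
    constructor
    · rintro rfl
      simp [IsPartition]
    · rintro ⟨h, -, h'⟩
      refine List.eq_nil_iff_forall_not_mem.2 fun x hx => ?_
      have := h.2 x hx
      have := h' x hx
      omega
  | case3 a b ih₁ ih₂ =>
    simp only [boxPartitions, Finset.mem_union, Finset.mem_map, Function.Embedding.coeFn_mk,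
      ih₁, ih₂]
    constructor
    · rintro (⟨h, h', h''⟩ | ⟨t, ⟨h, h', h''⟩, rfl⟩)
      · exact ⟨h, h', fun x hx => (h'' x hx).trans b.le_succ⟩
      · refine ⟨⟨List.pairwise_cons.2 ⟨h'', h.1⟩, ?_⟩, by simpa using h', ?_⟩
        · simpa using h.2
        · simpa using h''
    · rintro ⟨h, h', h''⟩
      rcases l with _ | ⟨x, t⟩
      · exact Or.inl ⟨h, h', by simp⟩
      · obtain ⟨hx, ht⟩ := List.pairwise_cons.1 h.1
        rcases (h'' x (by simp)).eq_or_lt with rfl | hlt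
        · refine Or.inr ⟨t, ⟨⟨ht, fun y hy => h.2 y (by simp [hy])⟩, by simpa using h', hx⟩, rfl⟩
        · refine Or.inl ⟨h, h', fun y hy => ?_⟩
          rcases List.mem_cons.1 hy with rfl | hy
          · omega
          · have := hx y hy
            omega

theorem sum_boxPartitions_succ_succ {M : Type*} [AddCommMonoid M] (f : List ℕ → M) (a b : ℕ) :
    ∑ l ∈ boxPartitions (a + 1) (b + 1), f l =
      ∑ l ∈ boxPartitions (a + 1) b, f l + ∑ l ∈ boxPartitions a (b + 1), f ((b + 1) :: l) := by
  rw [boxPartitions, Finset.sum_union, Finset.sum_map]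
  · rfl
  · refine Finset.disjoint_left.2 fun l hl hl' => ?_
    obtain ⟨t, -, rfl⟩ := Finset.mem_map.1 hl'
    have := (mem_boxPartitions.1 hl).2.2 (b + 1) (by simp)
    omega

theorem card_boxPartitions (a b : ℕ) : (boxPartitions a b).card = (a + b).choose b := by
  induction a, b using boxPartitions.induct with
  | case1 b => simp [boxPartitions]
  | case2 a => simp [boxPartitions]
  | case3 a b ih₁ ih₂ =>
    rw [Finset.card_eq_sum_ones] at *
    rw [sum_boxPartitions_succ_succ, ih₁, ih₂, show a + 1 + (b + 1) = a + 1 + b + 1 by ring,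
      Nat.choose_succ_succ, show a + (b + 1) = a + 1 + b by ring]

/-- The product formula for the Gaussian binomial coefficient, cleared of denominators. -/
theorem sum_boxPartitions_pow_mul_prod {R : Type*} [CommRing R] (q : R) (a b : ℕ) :
    (∑ l ∈ boxPartitions a b, q ^ l.sum) * ∏ i ∈ Finset.range b, (1 - q ^ (i + 1)) =
      ∏ i ∈ Finset.range b, (1 - q ^ (a + i + 1)) := by
  induction a, b using boxPartitions.induct with
  | case1 b => simp [boxPartitions]
  | case2 a => simp [boxPartitions]
  | case3 a b ih₁ ih₂ =>
    have shift : ∏ i ∈ Finset.range (b + 1), (1 - q ^ (a + i + 1)) =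
        (∏ i ∈ Finset.range b, (1 - q ^ (a + 1 + i + 1))) * (1 - q ^ (a + 1)) := by
      rw [Finset.prod_range_succ']
      simp only [add_zero, add_comm, add_left_comm]
    rw [shift] at ih₂
    simp only [sum_boxPartitions_succ_succ, List.sum_cons, pow_add q (b + 1), ← Finset.mul_sum]
    rw [add_mul, mul_assoc, ih₂, Finset.prod_range_succ, ← mul_assoc, ih₁,
      Finset.prod_range_succ, Nat.succ_eq_add_one]
    ring

theorem sum_boxPartitions_pow_eq_zero {R : Type*} [CommRing R] [IsDomain R] {ζ : R} {m a b : ℕ}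
    (hζ : IsPrimitiveRoot ζ m) (hb : b < m) (h : m ≤ a % m + b) :
    ∑ l ∈ boxPartitions a b, ζ ^ l.sum = 0 := by
  have ham : a % m < m := Nat.mod_lt _ (by omega)
  have key := sum_boxPartitions_pow_mul_prod ζ a b
  rw [Finset.prod_eq_zero (f := fun i => 1 - ζ ^ (a + i + 1)) (i := m - a % m - 1)
    (Finset.mem_range.2 (by omega)) ?_] at key
  · refine (mul_eq_zero.1 key).resolve_right (Finset.prod_ne_zero_iff.2 fun i hi => ?_)
    rw [Finset.mem_range] at hi
    exact sub_ne_zero.2 (hζ.pow_ne_one_of_pos_of_lt (by omega) (by omega)).symm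
  · rw [sub_eq_zero, eq_comm, hζ.pow_eq_one_iff_dvd]
    refine ⟨a / m + 1, ?_⟩
    have := Nat.div_add_mod a m
    rw [mul_add, mul_one]
    omega

theorem mul_card_boxPartitions_filter {m a b : ℕ} (hm : m.Prime) (hb : b < m)
    (h : m ≤ a % m + b) {ℓ : ℕ} (hℓ : ℓ < m) :
    m * ((boxPartitions a b).filter fun l => l.sum % m = ℓ).card = (a + b).choose b := by
  let c (j : ℕ) : ℕ := ((boxPartitions a b).filter fun l => l.sum % m = j).card
  have hζ := Complex.isPrimitiveRoot_exp m hm.ne_zero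
  set ζ := Complex.exp (2 * Real.pi * Complex.I / m)
  have maps : ∀ l ∈ boxPartitions a b, l.sum % m ∈ Finset.range m := fun l _ =>
    Finset.mem_range.2 (Nat.mod_lt _ hm.pos)
  have hsum : ∑ j : Fin m, ((c j : ℤ) : ℂ) * ζ ^ (j : ℕ) = 0 := by
    rw [Fin.sum_univ_eq_sum_range fun j => ((c j : ℤ) : ℂ) * ζ ^ j,
      ← sum_boxPartitions_pow_eq_zero hζ hb h, ← Finset.sum_fiberwise_of_maps_to maps]
    refine Finset.sum_congr rfl fun j _ => ?_
    rw [Finset.sum_congr rfl (g := fun _ => ζ ^ j), Finset.sum_const, nsmul_eq_mul]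
    · simp [c]
    · intro l hl
      rw [← (Finset.mem_filter.1 hl).2, hζ.eq_orderOf, pow_mod_orderOf]
  have hconst : ∀ j ∈ Finset.range m, c j = c ℓ := fun j hj => by
    exact_mod_cast (hζ.sum_eq_zero_iff_forall_eq_int hm fun j : Fin m => (c j : ℤ)).1 hsum
      ⟨j, Finset.mem_range.1 hj⟩ ⟨ℓ, hℓ⟩
  rw [← card_boxPartitions, Finset.card_eq_sum_card_fiberwise maps, Finset.sum_congr rfl hconst]
  simp [c]

/-- for a prime `m < k` with `k ≢ 0, -1 (mod m)`, the number of
partitions with at most `k - m + 1` parts, each at most `m - 2`, of size congruent to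
`ℓ` mod `m`, is `C(k-1, m-2)/m` for every `ℓ`; in particular `m ∣ C(k-1, m-2)`. -/
theorem sieved_gaussian_prime (k m : ℕ) (hp : m.Prime) (hmk : m < k)
    (h0 : k % m ≠ 0) (h1 : k % m ≠ m - 1) :
    m ∣ Nat.choose (k - 1) (m - 2) ∧
    ∀ ℓ : ℕ, ℓ < m →
      {l : List ℕ | IsPartition l ∧ l.length ≤ k - m + 1 ∧ (∀ x ∈ l, x ≤ m - 2) ∧
        l.sum % m = ℓ}.ncard = Nat.choose (k - 1) (m - 2) / m := by
  have hm := hp.two_le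
  have hb : m - 2 < m := by omega
  have hcarry : m ≤ (k - m + 1) % m + (m - 2) := by
    have hlt := Nat.mod_lt k hp.pos
    have hmod : (k - m + 1) % m = k % m + 1 := by
      rw [Nat.add_mod, ← Nat.mod_eq_sub_mod hmk.le, Nat.mod_eq_of_lt (a := 1) (by omega),
        Nat.mod_eq_of_lt (by omega)]
    omega
  have key {ℓ : ℕ} (hℓ : ℓ < m) := mul_card_boxPartitions_filter hp hb hcarry hℓ
  rw [show k - m + 1 + (m - 2) = k - 1 by omega] at key
  refine ⟨⟨_, (key hp.pos).symm⟩, fun ℓ hℓ => ?_⟩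
  rw [← key hℓ, Nat.mul_div_cancel_left _ hp.pos, ← Set.ncard_coe_finset]
  congr 1
  ext l
  simp [mem_boxPartitions, and_assoc]
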